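/- arXiv:1702.00628 — 2 statements merged into one kernel-verified Lean document; each statement's English description precedes it below -/
import Mathlib

section
/- The mean vector of the MSL_p(μ, Σ, γ) distribution is μ + (p+1)γ: for every integer p ≥ 1, every μ, γ ∈ ℝ^p and every symmetric positive definite p×p real matrix Σ, the vector-valued integral ∫_{ℝ^p} y · f_MSL(y) dy equals μ + (p+1)·γ. -/
open MeasureTheory Real Matrix

/-- Cauchy–Schlömilch substitution: `s ↦ α s - r / s` preserves, up to the factor `1 / α`, the
Gaussian integral. -/
lemma lintegral_Ioi_exp_neg_sq_mul_sub_div {α r : ℝ} (hα : 0 < α) (hr : 0 < r) :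
    ∫⁻ s in Set.Ioi (0 : ℝ), ENNReal.ofReal (exp (-(α * s - r / s) ^ 2 / 2)) =
      ENNReal.ofReal (√(2 * π) / (2 * α)) := by
  set J := ∫⁻ s in Set.Ioi (0 : ℝ), ENNReal.ofReal (exp (-(α * s - r / s) ^ 2 / 2)) with hJ
  have hG : Measurable fun s : ℝ ↦ ENNReal.ofReal (exp (-(α * s - r / s) ^ 2 / 2)) := by fun_prop
  have h_inv : J = ∫⁻ s in Set.Ioi (0 : ℝ), ENNReal.ofReal (r / (α * s ^ 2)) *
      ENNReal.ofReal (exp (-(α * s - r / s) ^ 2 / 2)) := by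
    have himg : (fun s : ℝ ↦ r / α / s) '' Set.Ioi 0 = Set.Ioi 0 := by
      ext v
      simp only [Set.mem_image, Set.mem_Ioi]
      constructor
      · rintro ⟨s, hs, rfl⟩
        positivity
      · intro hv
        exact ⟨r / α / v, by positivity, by field_simp⟩
    have hinj : Set.InjOn (fun s : ℝ ↦ r / α / s) (Set.Ioi 0) := by
      intro x (hx : 0 < x) y (hy : 0 < y) hxy
      simp only at hxy
      field_simp at hxy
      exact hxy.symm
    have hder : ∀ s ∈ Set.Ioi (0 : ℝ),
        HasDerivWithinAt (fun s : ℝ ↦ r / α / s) (-(r / (α * s ^ 2))) (Set.Ioi 0) s := by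
      intro s (hs : 0 < s)
      have := ((hasDerivAt_inv hs.ne').const_mul (r / α)).hasDerivWithinAt (s := Set.Ioi 0)
      convert! this using 1
      field_simp
    have := lintegral_image_eq_lintegral_abs_deriv_mul measurableSet_Ioi hder hinj
      fun s ↦ ENNReal.ofReal (exp (-(α * s - r / s) ^ 2 / 2))
    rw [himg] at this
    rw [hJ, this]
    refine setLIntegral_congr_fun measurableSet_Ioi fun s (hs : 0 < s) ↦ ?_
    have h1 : |-(r / (α * s ^ 2))| = r / (α * s ^ 2) := by
      rw [abs_neg, abs_of_pos (by positivity)]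
    have h2 : α * (r / α / s) - r / (r / α / s) = -(α * s - r / s) := by
      field_simp
      ring
    simp only [h1, h2, neg_sq]
  have h_sub : ∫⁻ s in Set.Ioi (0 : ℝ), ENNReal.ofReal (α + r / s ^ 2) *
      ENNReal.ofReal (exp (-(α * s - r / s) ^ 2 / 2)) = ENNReal.ofReal √(2 * π) := by
    have himg : (fun s : ℝ ↦ α * s - r / s) '' Set.Ioi 0 = Set.univ := by
      refine Set.eq_univ_of_forall fun v ↦ ?_
      have hlt : |v| < √(v ^ 2 + 4 * α * r) := by
        rw [← sqrt_sq_eq_abs]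
        exact sqrt_lt_sqrt (sq_nonneg v) (by nlinarith [mul_pos hα hr])
      have hsq : √(v ^ 2 + 4 * α * r) ^ 2 = v ^ 2 + 4 * α * r := sq_sqrt (by positivity)
      have hpos : 0 < v + √(v ^ 2 + 4 * α * r) := by linarith [neg_abs_le v]
      refine ⟨(v + √(v ^ 2 + 4 * α * r)) / (2 * α), by simp only [Set.mem_Ioi]; positivity, ?_⟩
      generalize √(v ^ 2 + 4 * α * r) = u at *
      field_simp
      linear_combination hsq
    have hinj : Set.InjOn (fun s : ℝ ↦ α * s - r / s) (Set.Ioi 0) := by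
      refine StrictMonoOn.injOn fun x (hx : 0 < x) y hy hxy ↦ ?_
      have h1 := mul_lt_mul_of_pos_left hxy hα
      have h2 := div_lt_div_of_pos_left hr hx hxy
      linarith
    have hder : ∀ s ∈ Set.Ioi (0 : ℝ),
        HasDerivWithinAt (fun s : ℝ ↦ α * s - r / s) (α + r / s ^ 2) (Set.Ioi 0) s := by
      intro s (hs : 0 < s)
      have := (((hasDerivAt_id s).const_mul α).sub
        ((hasDerivAt_inv hs.ne').const_mul r)).hasDerivWithinAt (s := Set.Ioi 0)
      convert! this using 1
      field_simp
      ring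
    have := lintegral_image_eq_lintegral_abs_deriv_mul measurableSet_Ioi hder hinj
      fun s ↦ ENNReal.ofReal (exp (-(1 / 2) * s ^ 2))
    rw [himg, Measure.restrict_univ, ← ofReal_integral_eq_lintegral_ofReal
      (integrable_exp_neg_mul_sq (by norm_num)) (.of_forall fun _ ↦ (exp_pos _).le),
      integral_gaussian] at this
    rw [show √(2 * π) = √(π / (1 / 2)) by congr 1; ring, this]
    refine setLIntegral_congr_fun measurableSet_Ioi fun s (hs : 0 < s) ↦ ?_
    rw [abs_of_pos (by positivity)]
    ring_nf
  have h_add : ENNReal.ofReal α * J + ENNReal.ofReal α * J = ENNReal.ofReal √(2 * π) := by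
    rw [← h_sub]
    conv_lhs => arg 2; rw [h_inv]
    rw [hJ, ← lintegral_const_mul _ hG, ← lintegral_const_mul _ (by fun_prop),
      ← lintegral_add_left (by fun_prop)]
    refine setLIntegral_congr_fun measurableSet_Ioi fun s (hs : 0 < s) ↦ ?_
    rw [← mul_assoc, ← ENNReal.ofReal_mul (q := r / (α * s ^ 2)) hα.le, ← add_mul,
      ← ENNReal.ofReal_add hα.le (by positivity)]
    congr 3
    field_simp
  rw [← two_mul, ← mul_assoc, ← ENNReal.ofReal_ofNat, ← ENNReal.ofReal_mul (by norm_num)] at h_add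
  rw [ENNReal.ofReal_div_of_pos (by positivity), ← h_add,
    mul_comm, ENNReal.mul_div_cancel_right (by simpa using hα) ENNReal.ofReal_ne_top]

/-- The exponential of a norm as a mixture of Gaussians. -/
lemma lintegral_Ioi_exp_neg_sq_sub_sq_div {α r : ℝ} (hα : 0 < α) (hr : 0 ≤ r) :
    ∫⁻ s in Set.Ioi (0 : ℝ), ENNReal.ofReal (exp (-(α ^ 2 * s ^ 2 / 2) - r ^ 2 / (2 * s ^ 2))) =
      ENNReal.ofReal (√(2 * π) / (2 * α) * exp (-α * r)) := by
  obtain rfl | hr := hr.eq_or_lt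
  · have := integral_gaussian_Ioi (α ^ 2 / 2)
    rw [show π / (α ^ 2 / 2) = 2 * π / α ^ 2 by field_simp, sqrt_div' _ (sq_nonneg α),
      sqrt_sq hα.le] at this
    simp only [mul_zero, exp_zero, mul_one]
    rw [show √(2 * π) / (2 * α) = √(2 * π) / α / 2 by field_simp, ← this,
      ofReal_integral_eq_lintegral_ofReal (integrable_exp_neg_mul_sq (by positivity)).integrableOn
        (.of_forall fun _ ↦ (exp_pos _).le)]
    refine lintegral_congr fun s ↦ ?_
    ring_nf
  · rw [ENNReal.ofReal_mul (by positivity), ← lintegral_Ioi_exp_neg_sq_mul_sub_div hα hr,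
      ← lintegral_mul_const _ (by fun_prop)]
    refine setLIntegral_congr_fun measurableSet_Ioi fun s (hs : 0 < s) ↦ ?_
    rw [← ENNReal.ofReal_mul (exp_pos _).le, ← exp_add]
    congr 2
    field_simp
    ring

section

variable {ι : Type*} [Fintype ι]

lemma lintegral_exp_neg_dotProduct_self_add {s : ℝ} (hs : 0 < s) (b : ι → ℝ) :
    ∫⁻ w : ι → ℝ, ENNReal.ofReal (exp (-(w ⬝ᵥ w) / (2 * s ^ 2) + w ⬝ᵥ b)) =
      ENNReal.ofReal ((√(2 * π) * s) ^ Fintype.card ι * exp (s ^ 2 * (b ⬝ᵥ b) / 2)) := by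
  have h_prod (w : ι → ℝ) : exp (-(w ⬝ᵥ w) / (2 * s ^ 2)) =
      ∏ i, exp (-(1 / (2 * s ^ 2)) * w i ^ 2) := by
    rw [← exp_sum, dotProduct, ← Finset.mul_sum]
    congr 1
    simp only [pow_two]
    ring
  have hint : Integrable fun w : ι → ℝ ↦ exp (-(w ⬝ᵥ w) / (2 * s ^ 2)) := by
    simp only [h_prod]
    exact Integrable.fintype_prod fun _ ↦ integrable_exp_neg_mul_sq (by positivity)
  have hval : ∫ w : ι → ℝ, exp (-(w ⬝ᵥ w) / (2 * s ^ 2)) = (√(2 * π) * s) ^ Fintype.card ι := by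
    simp only [h_prod]
    rw [integral_fintype_prod_volume_eq_pow fun x : ℝ ↦ exp (-(1 / (2 * s ^ 2)) * x ^ 2),
      integral_gaussian, show π / (1 / (2 * s ^ 2)) = 2 * π * s ^ 2 by field_simp,
      sqrt_mul' _ (sq_nonneg s), sqrt_sq hs.le]
  rw [← lintegral_add_right_eq_self _ (s ^ 2 • b), ENNReal.ofReal_mul (by positivity), ← hval,
    ofReal_integral_eq_lintegral_ofReal hint (.of_forall fun _ ↦ (exp_pos _).le),
    ← lintegral_mul_const _ (by fun_prop)]
  refine lintegral_congr fun w ↦ ?_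
  rw [← ENNReal.ofReal_mul (exp_pos _).le, ← exp_add]
  congr 2
  simp only [add_dotProduct, dotProduct_add, smul_dotProduct, dotProduct_smul, smul_eq_mul,
    dotProduct_comm b w]
  field_simp
  ring

/-- The moment generating function of the spherical Laplace density. -/
lemma lintegral_exp_neg_mul_sqrt_dotProduct_self_add {α : ℝ} (hα : 0 < α) {b : ι → ℝ}
    (hb : b ⬝ᵥ b < α ^ 2) :
    ∫⁻ w : ι → ℝ, ENNReal.ofReal (exp (-α * √(w ⬝ᵥ w) + w ⬝ᵥ b)) =
      ENNReal.ofReal (2 ^ Fintype.card ι * π ^ (((Fintype.card ι : ℝ) - 1) / 2) * α *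
        Gamma (((Fintype.card ι : ℝ) + 1) / 2) *
        (α ^ 2 - b ⬝ᵥ b) ^ (-((Fintype.card ι : ℝ) + 1) / 2)) := by
  have hκ : 0 < (α ^ 2 - b ⬝ᵥ b) / 2 := by linarith
  have hn : (0 : ℝ) ≤ Fintype.card ι := by positivity
  obtain ⟨n, hcard⟩ : ∃ n, Fintype.card ι = n := ⟨_, rfl⟩
  rw [hcard] at hn ⊢
  have hself (w : ι → ℝ) : 0 ≤ w ⬝ᵥ w := by simpa using dotProduct_star_self_nonneg w
  have h_mix (w : ι → ℝ) : ENNReal.ofReal (exp (-α * √(w ⬝ᵥ w) + w ⬝ᵥ b)) =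
      ENNReal.ofReal (2 * α / √(2 * π)) * ∫⁻ s in Set.Ioi (0 : ℝ), ENNReal.ofReal
        (exp (-(α ^ 2 * s ^ 2 / 2)) * exp (-(w ⬝ᵥ w) / (2 * s ^ 2) + w ⬝ᵥ b)) := by
    have h := lintegral_Ioi_exp_neg_sq_sub_sq_div hα (sqrt_nonneg (w ⬝ᵥ w))
    have h' : ∫⁻ s in Set.Ioi (0 : ℝ), ENNReal.ofReal
        (exp (-(α ^ 2 * s ^ 2 / 2)) * exp (-(w ⬝ᵥ w) / (2 * s ^ 2) + w ⬝ᵥ b)) =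
        ENNReal.ofReal (√(2 * π) / (2 * α) * exp (-α * √(w ⬝ᵥ w))) *
          ENNReal.ofReal (exp (w ⬝ᵥ b)) := by
      rw [← h, ← lintegral_mul_const _ (by fun_prop)]
      refine lintegral_congr fun s ↦ ?_
      rw [← ENNReal.ofReal_mul (exp_pos _).le, ← exp_add, ← exp_add, sq_sqrt (hself w)]
      congr 2
      ring
    rw [h', ← ENNReal.ofReal_mul (by positivity), ← ENNReal.ofReal_mul (by positivity), exp_add]
    congr 1
    field_simp
  have h_gauss : ∀ s ∈ Set.Ioi (0 : ℝ), ∫⁻ w : ι → ℝ, ENNReal.ofReal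
        (exp (-(α ^ 2 * s ^ 2 / 2)) * exp (-(w ⬝ᵥ w) / (2 * s ^ 2) + w ⬝ᵥ b)) =
      ENNReal.ofReal (√(2 * π) ^ n * (s ^ (n : ℝ) *
        exp (-((α ^ 2 - b ⬝ᵥ b) / 2) * s ^ (2 : ℝ)))) := by
    intro s hs
    simp only [ENNReal.ofReal_mul (exp_pos _).le]
    rw [lintegral_const_mul _ (by fun_prop), lintegral_exp_neg_dotProduct_self_add hs b, hcard,
      ← ENNReal.ofReal_mul (exp_pos _).le, mul_left_comm, ← exp_add, mul_pow, rpow_natCast,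
      rpow_two, mul_assoc]
    ring_nf
  simp only [h_mix]
  rw [lintegral_const_mul' _ _ ENNReal.ofReal_ne_top,
    lintegral_lintegral_swap (by fun_prop), setLIntegral_congr_fun measurableSet_Ioi h_gauss,
    ← ofReal_integral_eq_lintegral_ofReal
      ((integrableOn_rpow_mul_exp_neg_mul_rpow (by linarith) two_pos hκ).const_mul _)
      ((ae_restrict_iff' measurableSet_Ioi).2 (.of_forall fun s (hs : 0 < s) ↦ by positivity)),
    integral_const_mul, integral_rpow_mul_exp_neg_mul_rpow two_pos (by linarith) hκ,
    ← ENNReal.ofReal_mul (by positivity)]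
  congr 1
  have h1 : √(2 * π) ^ n / √(2 * π) = (2 * π) ^ (((n : ℝ) - 1) / 2) := by
    rw [sqrt_eq_rpow, ← rpow_natCast, ← rpow_mul (by positivity), ← rpow_sub (by positivity)]
    ring_nf
  have h2 : (2 : ℝ) ^ (((n : ℝ) - 1) / 2) / 2 ^ (-((n : ℝ) + 1) / 2) = 2 ^ n := by
    rw [← rpow_sub two_pos, ← rpow_natCast]
    ring_nf
  rw [mul_rpow two_pos.le pi_pos.le] at h1
  rw [div_rpow (by linarith) two_pos.le, ← h2]
  field_simp at h1 ⊢
  rw [h1]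

variable [DecidableEq ι]

open scoped MatrixOrder in
lemma Matrix.PosDef.exists_eq_transpose_mul_self {S : Matrix ι ι ℝ} (hS : S.PosDef) :
    ∃ B : Matrix ι ι ℝ, S = Bᵀ * B := by
  obtain ⟨B, hB⟩ := CStarAlgebra.nonneg_iff_eq_star_mul_self.1 hS.posSemidef.nonneg
  exact ⟨B, by rw [hB, star_eq_conjTranspose, conjTranspose_eq_transpose_of_trivial]⟩

/-- The total mass, up to the factor `(α² - bᵀSb) ^ (-(n + 1) / 2)`, of the elliptical Laplace
weight with scale matrix `S`. -/
noncomputable def laplaceConst (S : Matrix ι ι ℝ) (α : ℝ) : ℝ :=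
  √S.det * (2 ^ Fintype.card ι * π ^ (((Fintype.card ι : ℝ) - 1) / 2) * α *
    Gamma (((Fintype.card ι : ℝ) + 1) / 2))

lemma laplaceConst_nonneg (S : Matrix ι ι ℝ) {α : ℝ} (hα : 0 < α) : 0 ≤ laplaceConst S α := by
  have := Gamma_pos_of_pos (show 0 < ((Fintype.card ι : ℝ) + 1) / 2 by positivity)
  unfold laplaceConst
  positivity

lemma lintegral_exp_neg_mul_sqrt_dotProduct_inv_mulVec_add {S : Matrix ι ι ℝ} (hS : S.PosDef)
    {α : ℝ} (hα : 0 < α) {b : ι → ℝ} (hb : b ⬝ᵥ S *ᵥ b < α ^ 2) :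
    ∫⁻ z : ι → ℝ, ENNReal.ofReal (exp (-α * √(z ⬝ᵥ S⁻¹ *ᵥ z) + z ⬝ᵥ b)) =
      ENNReal.ofReal (laplaceConst S α *
        (α ^ 2 - b ⬝ᵥ S *ᵥ b) ^ (-((Fintype.card ι : ℝ) + 1) / 2)) := by
  obtain ⟨B, rfl⟩ := hS.exists_eq_transpose_mul_self
  have hdet : B.det ≠ 0 := fun h ↦ hS.det_pos.ne' (by simp [h])
  have hunit : IsUnit B.det := isUnit_iff_ne_zero.2 hdet
  have hunit' : IsUnit Bᵀ.det := by rwa [det_transpose]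
  have hbb : b ⬝ᵥ (Bᵀ * B) *ᵥ b = (B *ᵥ b) ⬝ᵥ (B *ᵥ b) := by
    rw [← mulVec_mulVec, dotProduct_mulVec, vecMul_transpose]
  have hquad (w : ι → ℝ) : (Bᵀ *ᵥ w) ⬝ᵥ (Bᵀ * B)⁻¹ *ᵥ (Bᵀ *ᵥ w) = w ⬝ᵥ w := by
    rw [mulVec_mulVec, Matrix.mul_inv_rev, nonsing_inv_mul_cancel_right _ _ hunit',
      mulVec_transpose, ← dotProduct_mulVec, mulVec_mulVec, mul_nonsing_inv _ hunit, one_mulVec]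
  have hlin (w : ι → ℝ) : (Bᵀ *ᵥ w) ⬝ᵥ b = w ⬝ᵥ (B *ᵥ b) := by
    rw [mulVec_transpose, ← dotProduct_mulVec]
  have hsqrt : √(Bᵀ * B).det = |B.det| := by
    rw [det_mul, det_transpose, ← pow_two, sqrt_sq_eq_abs]
  have hmap := Real.map_matrix_volume_pi_eq_smul_volume_pi hunit'.ne_zero
  rw [det_transpose] at hmap
  have hvol : (volume : Measure (ι → ℝ)) =
      ENNReal.ofReal |B.det| • Measure.map (toLin' Bᵀ) volume := by
    rw [hmap, smul_smul, ← ENNReal.ofReal_mul (abs_nonneg _), ← abs_mul, mul_inv_cancel₀ hdet,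
      abs_one, ENNReal.ofReal_one, one_smul]
  rw [hbb] at hb ⊢
  rw [hvol, lintegral_smul_measure, lintegral_map (by fun_prop)
    (LinearMap.continuous_of_finiteDimensional _).measurable]
  simp only [toLin'_apply, hquad, hlin]
  rw [lintegral_exp_neg_mul_sqrt_dotProduct_self_add hα hb, laplaceConst, hsqrt, smul_eq_mul,
    ← ENNReal.ofReal_mul (abs_nonneg _), mul_assoc |B.det|]

lemma integrable_exp_neg_mul_sqrt_dotProduct_inv_mulVec_add {S : Matrix ι ι ℝ} (hS : S.PosDef)
    {α : ℝ} (hα : 0 < α) {b : ι → ℝ} (hb : b ⬝ᵥ S *ᵥ b < α ^ 2) :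
    Integrable fun z : ι → ℝ ↦ exp (-α * √(z ⬝ᵥ S⁻¹ *ᵥ z) + z ⬝ᵥ b) := by
  have hcont : Continuous fun z : ι → ℝ ↦ exp (-α * √(z ⬝ᵥ S⁻¹ *ᵥ z) + z ⬝ᵥ b) := by fun_prop
  refine (lintegral_ofReal_ne_top_iff_integrable hcont.aestronglyMeasurable
    (.of_forall fun _ ↦ (exp_pos _).le)).1 ?_
  rw [lintegral_exp_neg_mul_sqrt_dotProduct_inv_mulVec_add hS hα hb]
  exact ENNReal.ofReal_ne_top

lemma integral_exp_neg_mul_sqrt_dotProduct_inv_mulVec_add {S : Matrix ι ι ℝ} (hS : S.PosDef)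
    {α : ℝ} (hα : 0 < α) {b : ι → ℝ} (hb : b ⬝ᵥ S *ᵥ b < α ^ 2) :
    ∫ z : ι → ℝ, exp (-α * √(z ⬝ᵥ S⁻¹ *ᵥ z) + z ⬝ᵥ b) =
      laplaceConst S α * (α ^ 2 - b ⬝ᵥ S *ᵥ b) ^ (-((Fintype.card ι : ℝ) + 1) / 2) := by
  have hint := integrable_exp_neg_mul_sqrt_dotProduct_inv_mulVec_add hS hα hb
  rw [integral_eq_lintegral_of_nonneg_ae (.of_forall fun _ ↦ (exp_pos _).le)
    hint.aestronglyMeasurable, lintegral_exp_neg_mul_sqrt_dotProduct_inv_mulVec_add hS hα hb,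
    ENNReal.toReal_ofReal]
  exact mul_nonneg (laplaceConst_nonneg S hα) (rpow_nonneg (by linarith) _)

/-- The first moments of the exponentially tilted elliptical Laplace weight, obtained by
differentiating its total mass in the tilt `b`. -/
lemma integral_eval_mul_exp_neg_mul_sqrt_dotProduct_inv_mulVec_add {S : Matrix ι ι ℝ}
    (hS : S.PosDef) {α : ℝ} (hα : 0 < α) {b : ι → ℝ} (hb : b ⬝ᵥ S *ᵥ b < α ^ 2) (i : ι) :
    Integrable (fun z : ι → ℝ ↦ exp (-α * √(z ⬝ᵥ S⁻¹ *ᵥ z) + z ⬝ᵥ b) * z i) ∧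
    ∫ z : ι → ℝ, exp (-α * √(z ⬝ᵥ S⁻¹ *ᵥ z) + z ⬝ᵥ b) * z i =
      ((Fintype.card ι : ℝ) + 1) * laplaceConst S α * (S *ᵥ b) i *
        (α ^ 2 - b ⬝ᵥ S *ᵥ b) ^ (-((Fintype.card ι : ℝ) + 1) / 2 - 1) := by
  set f : (ι → ℝ) → ℝ := fun z ↦ exp (-α * √(z ⬝ᵥ S⁻¹ *ᵥ z) + z ⬝ᵥ b) with hf
  set ν : Measure (ι → ℝ) := volume.withDensity fun z ↦ ENNReal.ofReal (f z) with hν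
  have hf_meas : Measurable fun z ↦ ENNReal.ofReal (f z) := by fun_prop
  have hf_nonneg (z) : 0 ≤ f z := (exp_pos _).le
  have hf_lt : ∀ᵐ z : ι → ℝ, ENNReal.ofReal (f z) < ⊤ := .of_forall fun _ ↦ ENNReal.ofReal_lt_top
  have hint_iff (g : (ι → ℝ) → ℝ) : Integrable g ν ↔ Integrable fun z ↦ f z * g z := by
    rw [hν, integrable_withDensity_iff_integrable_smul' hf_meas hf_lt]
    simp only [ENNReal.toReal_ofReal (hf_nonneg _), smul_eq_mul]
  have hintegral (g : (ι → ℝ) → ℝ) : ∫ z, g z ∂ν = ∫ z, f z * g z := by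
    rw [hν, integral_withDensity_eq_integral_toReal_smul hf_meas hf_lt]
    simp only [ENNReal.toReal_ofReal (hf_nonneg _), smul_eq_mul]
  let β (t : ℝ) : ι → ℝ := b + t • Pi.single i 1
  have htilt (t : ℝ) (z : ι → ℝ) :
      f z * exp (t * z i) = exp (-α * √(z ⬝ᵥ S⁻¹ *ᵥ z) + z ⬝ᵥ β t) := by
    simp only [hf, β, ← exp_add, dotProduct_add, dotProduct_smul, dotProduct_single, smul_eq_mul,
      mul_one, add_assoc]
  have hsymm : b ⬝ᵥ S.col i = (S *ᵥ b) i := by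
    have hT : Sᵀ = S := by simpa using hS.isHermitian.eq
    rw [← mulVec_single_one, dotProduct_mulVec, dotProduct_single, mul_one,
      ← mulVec_transpose, hT]
  have hβ (t : ℝ) : β t ⬝ᵥ S *ᵥ β t = b ⬝ᵥ S *ᵥ b + 2 * t * (S *ᵥ b) i + t ^ 2 * S i i := by
    simp only [β, mulVec_add, mulVec_smul, dotProduct_add, add_dotProduct, smul_dotProduct,
      dotProduct_smul, smul_eq_mul, hsymm, single_dotProduct, one_mul, mulVec_single_one, col_apply]
    ring
  have hnear : ∀ᶠ t in nhds (0 : ℝ), β t ⬝ᵥ S *ᵥ β t < α ^ 2 := by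
    refine ContinuousAt.eventually_lt (by fun_prop) continuousAt_const ?_
    simpa [β] using hb
  have hmem : (0 : ℝ) ∈ interior (ProbabilityTheory.integrableExpSet (fun z ↦ z i) ν) := by
    rw [mem_interior_iff_mem_nhds]
    filter_upwards [hnear] with t ht
    rw [ProbabilityTheory.integrableExpSet, Set.mem_ofPred_eq, hint_iff]
    simpa only [htilt] using integrable_exp_neg_mul_sqrt_dotProduct_inv_mulVec_add hS hα ht
  have hmgf : ProbabilityTheory.mgf (fun z ↦ z i) ν =ᶠ[nhds 0] fun t ↦ laplaceConst S α *
      (α ^ 2 - (b ⬝ᵥ S *ᵥ b + 2 * t * (S *ᵥ b) i + t ^ 2 * S i i)) ^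
        (-((Fintype.card ι : ℝ) + 1) / 2) := by
    filter_upwards [hnear] with t ht
    rw [ProbabilityTheory.mgf, hintegral, ← hβ]
    simpa only [htilt] using integral_exp_neg_mul_sqrt_dotProduct_inv_mulVec_add hS hα ht
  constructor
  · rw [← hint_iff]
    simpa using ProbabilityTheory.integrable_pow_of_mem_interior_integrableExpSet hmem 1
  · have hquad : HasDerivAt
        (fun t : ℝ ↦ α ^ 2 - (b ⬝ᵥ S *ᵥ b + 2 * t * (S *ᵥ b) i + t ^ 2 * S i i))
        (-(2 * (S *ᵥ b) i)) 0 := by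
      have h1 := (((hasDerivAt_id (0 : ℝ)).const_mul 2).mul_const ((S *ᵥ b) i)).const_add
        (b ⬝ᵥ S *ᵥ b)
      have h2 := ((hasDerivAt_id (0 : ℝ)).pow 2).mul_const (S i i)
      convert! (h1.add h2).const_sub (α ^ 2) using 1
      simp
    have hpow := (hquad.rpow_const (p := -((Fintype.card ι : ℝ) + 1) / 2)
      (.inl (by simpa using (sub_pos.2 hb).ne'))).const_mul (laplaceConst S α)
    have huniq := (ProbabilityTheory.hasDerivAt_mgf hmem).unique (hpow.congr_of_eventuallyEq hmgf)
    simp only [zero_mul, exp_zero, mul_one, mul_zero, ne_eq, OfNat.ofNat_ne_zero,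
      not_false_eq_true, zero_pow, add_zero] at huniq
    rw [← hintegral, huniq]
    ring

end

/-- The mean vector of the multivariate skew Laplace distribution `MSL_p(μ, Σ, γ)`
is `μ + (p+1)γ`. -/
theorem msl_mean
    (p : ℕ) (hp : 1 ≤ p) (μ γ : Fin p → ℝ)
    (S : Matrix (Fin p) (Fin p) ℝ) (hS : S.PosDef) :
    ∫ y : Fin p → ℝ,
      (S.det ^ (-(1:ℝ)/2) /
          ((2:ℝ) ^ p * π ^ (((p:ℝ) - 1)/2) *
            Real.sqrt (1 + γ ⬝ᵥ S⁻¹ *ᵥ γ) * Real.Gamma (((p:ℝ) + 1)/2)) *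
        Real.exp (-(Real.sqrt (1 + γ ⬝ᵥ S⁻¹ *ᵥ γ)) *
            Real.sqrt ((y - μ) ⬝ᵥ S⁻¹ *ᵥ (y - μ)) +
          (y - μ) ⬝ᵥ S⁻¹ *ᵥ γ)) • y
    = μ + ((p : ℝ) + 1) • γ := by
  have hdet := hS.det_pos
  have hγ : 0 ≤ γ ⬝ᵥ S⁻¹ *ᵥ γ := by
    simpa using hS.inv.posSemidef.dotProduct_mulVec_nonneg γ
  have hα : 0 < √(1 + γ ⬝ᵥ S⁻¹ *ᵥ γ) := by positivity
  have hα_sq : √(1 + γ ⬝ᵥ S⁻¹ *ᵥ γ) ^ 2 = 1 + γ ⬝ᵥ S⁻¹ *ᵥ γ := sq_sqrt (by positivity)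
  generalize √(1 + γ ⬝ᵥ S⁻¹ *ᵥ γ) = α at hα hα_sq ⊢
  have hSb : S *ᵥ (S⁻¹ *ᵥ γ) = γ := by
    rw [mulVec_mulVec, mul_nonsing_inv _ hdet.ne'.isUnit, one_mulVec]
  have hgap : α ^ 2 - (S⁻¹ *ᵥ γ) ⬝ᵥ S *ᵥ (S⁻¹ *ᵥ γ) = 1 := by
    rw [hSb, hα_sq, dotProduct_comm]
    ring
  have hb : (S⁻¹ *ᵥ γ) ⬝ᵥ S *ᵥ (S⁻¹ *ᵥ γ) < α ^ 2 := by linarith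
  have hint₀ := integrable_exp_neg_mul_sqrt_dotProduct_inv_mulVec_add hS hα hb
  have hval₀ := integral_exp_neg_mul_sqrt_dotProduct_inv_mulVec_add hS hα hb
  have hmoment := integral_eval_mul_exp_neg_mul_sqrt_dotProduct_inv_mulVec_add hS hα hb
  rw [hSb] at hgap
  simp only [hSb, hgap, one_rpow, mul_one, Fintype.card_fin] at hval₀ hmoment
  set c := S.det ^ (-(1:ℝ)/2) / ((2:ℝ) ^ p * π ^ (((p:ℝ) - 1)/2) * α * Gamma (((p:ℝ) + 1)/2))
    with hc
  have hnorm : c * laplaceConst S α = 1 := by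
    have hΓ := Gamma_pos_of_pos (show 0 < ((p : ℝ) + 1) / 2 by positivity)
    have hroot : S.det ^ (-(1:ℝ)/2) * √S.det = 1 := by
      rw [sqrt_eq_rpow, ← rpow_add hdet]
      norm_num
    rw [hc, laplaceConst, Fintype.card_fin, div_mul_eq_mul_div, ← mul_assoc, hroot, one_mul,
      div_self (by positivity)]
  rw [← integral_add_right_eq_self _ μ]
  simp only [add_sub_cancel_right]
  have hsplit (z : Fin p → ℝ) (i : Fin p) :
      ((c * exp (-α * √(z ⬝ᵥ S⁻¹ *ᵥ z) + z ⬝ᵥ S⁻¹ *ᵥ γ)) • (z + μ)) i =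
        c * (exp (-α * √(z ⬝ᵥ S⁻¹ *ᵥ z) + z ⬝ᵥ S⁻¹ *ᵥ γ) * z i +
          exp (-α * √(z ⬝ᵥ S⁻¹ *ᵥ z) + z ⬝ᵥ S⁻¹ *ᵥ γ) * μ i) := by
    simp only [Pi.smul_apply, Pi.add_apply, smul_eq_mul]
    ring
  ext i
  rw [eval_integral fun i ↦ ?_]
  · simp only [hsplit]
    rw [integral_const_mul, integral_add (hmoment i).1 (hint₀.mul_const _), (hmoment i).2,
      integral_mul_const, hval₀, Pi.add_apply, Pi.smul_apply, smul_eq_mul]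
    linear_combination (((p : ℝ) + 1) * γ i + μ i) * hnorm
  · simp only [hsplit]
    exact ((hmoment i).1.add (hint₀.mul_const _)).const_mul _
end

section
/- The normalization integral underlying the conditional density (3) of the MSL distribution: for all real numbers a > 0 and b > 0, ∫_0^∞ v^{-3/2} · exp( −½ (a·v + b·v^{-1}) ) dv = √(2π/b) · exp(−√(a·b)). -/
open MeasureTheory Real

lemma hasDerivAt_mul_sub_div (p q : ℝ) {x : ℝ} (hx : x ≠ 0) :
    HasDerivAt (fun x : ℝ => p * x - q / x) (p + q / x ^ 2) x := by
  have h := ((hasDerivAt_id x).const_mul p).sub ((hasDerivAt_inv hx).const_mul q)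
  refine h.congr_deriv ?_
  ring

lemma injOn_mul_sub_div {p q : ℝ} (hp : 0 < p) (hq : 0 < q) :
    Set.InjOn (fun x : ℝ => p * x - q / x) (Set.Ioi 0) := by
  intro x hx y hy h
  have hx' : 0 < x := hx
  have hy' : 0 < y := hy
  have key : (x - y) * (p * (x * y) + q) = 0 := by
    simp only at h
    field_simp at h
    linear_combination h
  rcases mul_eq_zero.mp key with h | h
  · linarith
  · have : 0 < p * (x * y) + q := by positivity
    linarith

lemma image_mul_sub_div_Ioi {p q : ℝ} (hp : 0 < p) (hq : 0 < q) :
    (fun x : ℝ => p * x - q / x) '' Set.Ioi 0 = Set.univ := by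
  refine Set.eq_univ_of_forall fun u => ?_
  have hd : 0 < u ^ 2 + 4 * p * q := by positivity
  have hs : |u| < √(u ^ 2 + 4 * p * q) := by
    rw [← Real.sqrt_sq_eq_abs]
    exact Real.sqrt_lt_sqrt (sq_nonneg u) (by nlinarith [mul_pos hp hq])
  have hpos : 0 < u + √(u ^ 2 + 4 * p * q) := by linarith [neg_abs_le u]
  have hsq := Real.sq_sqrt hd.le
  refine ⟨(u + √(u ^ 2 + 4 * p * q)) / (2 * p), by simp only [Set.mem_Ioi]; positivity, ?_⟩
  set s := √(u ^ 2 + 4 * p * q)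
  simp only
  field_simp
  linear_combination hsq

/-- The Cauchy–Schlömilch transformation of the Gaussian integral. -/
lemma integral_exp_neg_mul_sub_div_sq {p q : ℝ} (hp : 0 < p) (hq : 0 < q) :
    ∫ x in Set.Ioi (0 : ℝ), Real.exp (-(p * x - q / x) ^ 2) = √π / (2 * p) := by
  have hderiv : ∀ x ∈ Set.Ioi (0 : ℝ), HasDerivWithinAt (fun x : ℝ => p * x - q / x)
      (p + q / x ^ 2) (Set.Ioi 0) x := fun x hx =>
    (hasDerivAt_mul_sub_div p q (ne_of_gt hx)).hasDerivWithinAt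
  have hgauss : Integrable (fun u : ℝ => Real.exp (-u ^ 2)) := by
    simpa using integrable_exp_neg_mul_sq (b := 1) one_pos
  have hint := (integrableOn_image_iff_integrableOn_abs_deriv_smul measurableSet_Ioi hderiv
    (injOn_mul_sub_div hp hq) (fun u : ℝ => Real.exp (-u ^ 2))).mp hgauss.integrableOn
  have heq := integral_image_eq_integral_abs_deriv_smul measurableSet_Ioi hderiv
    (injOn_mul_sub_div hp hq) (fun u : ℝ => Real.exp (-u ^ 2))
  have hval : ∫ u : ℝ, Real.exp (-u ^ 2) = √π := by
    simpa using integral_gaussian 1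
  rw [image_mul_sub_div_Ioi hp hq, setIntegral_univ, hval] at heq
  have hF : IntegrableOn (fun x : ℝ => p * Real.exp (-(p * x - q / x) ^ 2)) (Set.Ioi 0) := by
    refine Integrable.mono' hint (by fun_prop) ?_
    refine ae_restrict_of_forall_mem measurableSet_Ioi fun x hx => ?_
    rw [Real.norm_of_nonneg (by positivity), smul_eq_mul, abs_of_nonneg (by positivity)]
    gcongr
    linarith [show 0 ≤ q / x ^ 2 by positivity]
  have hG : IntegrableOn (fun x : ℝ => q / x ^ 2 * Real.exp (-(p * x - q / x) ^ 2))
      (Set.Ioi 0) := by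
    refine (Integrable.sub hint hF).congr ?_
    refine ae_restrict_of_forall_mem measurableSet_Ioi fun x hx => ?_
    simp only [Pi.sub_apply, smul_eq_mul]
    rw [abs_of_nonneg (by positivity)]
    ring
  have hsum : √π = (∫ x in Set.Ioi (0 : ℝ), p * Real.exp (-(p * x - q / x) ^ 2)) +
      ∫ x in Set.Ioi (0 : ℝ), q / x ^ 2 * Real.exp (-(p * x - q / x) ^ 2) := by
    rw [heq, ← integral_add hF hG]
    refine setIntegral_congr_fun measurableSet_Ioi fun x hx => ?_
    simp only [smul_eq_mul]
    rw [abs_of_nonneg (by positivity)]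
    ring
  have hrefl : ∫ x in Set.Ioi (0 : ℝ), Real.exp (-(p * x - q / x) ^ 2) =
      ∫ x in Set.Ioi (0 : ℝ), q / p / x ^ 2 * Real.exp (-(p * x - q / x) ^ 2) := by
    have hd : ∀ x ∈ Set.Ioi (0 : ℝ), HasDerivWithinAt (fun x : ℝ => q / p / x)
        (-(q / p / x ^ 2)) (Set.Ioi 0) x := fun x hx => by
      have h := (hasDerivAt_inv (ne_of_gt hx)).const_mul (q / p)
      refine (h.congr_deriv ?_).hasDerivWithinAt
      ring
    have hinj : Set.InjOn (fun x : ℝ => q / p / x) (Set.Ioi 0) := by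
      intro x hx y hy h
      have hx' : 0 < x := hx
      have hy' : 0 < y := hy
      simp only at h
      field_simp at h
      exact h.symm
    have himg : (fun x : ℝ => q / p / x) '' Set.Ioi 0 = Set.Ioi 0 := by
      ext y
      constructor
      · rintro ⟨x, hx, rfl⟩
        have hx' : 0 < x := hx
        simp only [Set.mem_Ioi]
        positivity
      · intro hy
        have hy' : 0 < y := hy
        refine ⟨q / p / y, by simp only [Set.mem_Ioi]; positivity, ?_⟩
        simp only
        field_simp
    have h := integral_image_eq_integral_abs_deriv_smul measurableSet_Ioi hd hinj
      (fun x : ℝ => Real.exp (-(p * x - q / x) ^ 2))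
    rw [himg] at h
    rw [h]
    refine setIntegral_congr_fun measurableSet_Ioi fun x hx => ?_
    have hx' : 0 < x := hx
    simp only [smul_eq_mul]
    rw [abs_neg, abs_of_nonneg (by positivity)]
    congr 2
    field_simp
    ring
  have hrefl' : ∫ x in Set.Ioi (0 : ℝ), q / x ^ 2 * Real.exp (-(p * x - q / x) ^ 2) =
      p * ∫ x in Set.Ioi (0 : ℝ), Real.exp (-(p * x - q / x) ^ 2) := by
    rw [hrefl, ← integral_const_mul]
    congr 1
    ext x
    field_simp
  rw [hrefl', integral_const_mul] at hsum
  rw [eq_div_iff (by positivity), hsum]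
  ring

/-- Normalization integral underlying the conditional density (3):
`∫_0^∞ v^{-3/2} exp(−½(av + b/v)) dv = √(2π/b) · exp(−√(ab))`. -/
theorem integral_rpow_neg_three_halves_exp
    (a b : ℝ) (ha : 0 < a) (hb : 0 < b) :
    ∫ v in Set.Ioi (0:ℝ),
      v ^ (-(3:ℝ)/2) * Real.exp (-(1/2) * (a * v + b * v⁻¹))
    = Real.sqrt (2 * π / b) * Real.exp (-Real.sqrt (a * b)) := by
  have hp : 0 < √(b / 2) := Real.sqrt_pos.mpr (by positivity)
  have hq : 0 < √(a / 2) := Real.sqrt_pos.mpr (by positivity)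
  have hp2 : √(b / 2) ^ 2 = b / 2 := Real.sq_sqrt (by positivity)
  have hq2 : √(a / 2) ^ 2 = a / 2 := Real.sq_sqrt (by positivity)
  have hpq : 2 * (√(b / 2) * √(a / 2)) = √(a * b) := by
    symm
    rw [Real.sqrt_eq_iff_mul_self_eq (by positivity) (by positivity)]
    linear_combination -4 * √(a / 2) ^ 2 * hp2 - 2 * b * hq2
  have hconst : √(2 * π / b) = √π / √(b / 2) := by
    rw [← Real.sqrt_div' _ (by positivity)]
    congr 1
    field_simp
  rw [← integral_comp_rpow_Ioi _ (show (-2 : ℝ) ≠ 0 by norm_num)]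
  calc _ = ∫ x in Set.Ioi (0 : ℝ), 2 * Real.exp (-√(a * b)) *
        Real.exp (-(√(b / 2) * x - √(a / 2) / x) ^ 2) := by
        refine setIntegral_congr_fun measurableSet_Ioi fun x hx => ?_
        have hx' : 0 < x := hx
        have hpow : x ^ (-2 - 1 : ℝ) * (x ^ (-2 : ℝ)) ^ (-(3 : ℝ) / 2) = 1 := by
          rw [← Real.rpow_mul hx'.le, ← Real.rpow_add hx']
          norm_num
        have hx2 : x ^ (-2 : ℝ) = (x ^ 2)⁻¹ := by
          rw [Real.rpow_neg hx'.le, Real.rpow_two]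
        have hexp : -(1 / 2) * (a * x ^ (-2 : ℝ) + b * (x ^ (-2 : ℝ))⁻¹) =
            -√(a * b) + -(√(b / 2) * x - √(a / 2) / x) ^ 2 := by
          have hsq : (√(b / 2) * x - √(a / 2) / x) ^ 2 = √(b / 2) ^ 2 * x ^ 2
              - 2 * (√(b / 2) * √(a / 2)) + √(a / 2) ^ 2 * (x ^ 2)⁻¹ := by
            field_simp
            ring
          rw [hsq, hp2, hq2, hpq, hx2, inv_inv]
          ring
        simp only [smul_eq_mul]
        rw [hexp, Real.exp_add, abs_neg, abs_two]
        linear_combination 2 * Real.exp (-√(a * b)) *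
          Real.exp (-(√(b / 2) * x - √(a / 2) / x) ^ 2) * hpow
    _ = _ := by
        rw [integral_const_mul, integral_exp_neg_mul_sub_div_sq hp hq, hconst]
        field_simp
end
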